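/- arXiv:2101.08125 — 3 statements merged into one kernel-verified Lean document; each statement's English description precedes it below -/
import Mathlib

section
/- Let λ > 0 and u : [0,T] → ℝ, and for k ≥ 1 define v_k = ∫_0^{t_{k−1}} Π₁u′(τ)·e^{−λ(t_k−τ)/T} dτ (so v_1 = 0). Then for every 2 ≤ k ≤ n, v_k = e^{−λΔt/T}·v_{k−1} + T·(e^{−λΔt/T} − e^{−2λΔt/T})/(λΔt) · (u(t_{k−1}) − u(t_{k−2})). -/
open Real MeasureTheory Finset

/-- Time step `Δt = T / n`. -/
noncomputable def dt (T : ℝ) (n : ℕ) : ℝ := T / n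

/-- Time grid point `t_k = k Δt`. -/
noncomputable def tk (T : ℝ) (n k : ℕ) : ℝ := k * dt T n

/-- Quadrature exponent `λ_i = e^{i h}`. -/
noncomputable def lamESA (h : ℝ) (i : ℤ) : ℝ := Real.exp ((i : ℝ) * h)

/-- Quadrature weight `θ_{a,i} = h e^{a i h} / Γ(a)`. -/
noncomputable def thESA (a h : ℝ) (i : ℤ) : ℝ := h * Real.exp (a * (i : ℝ) * h) / Real.Gamma a

/-- Piecewise-constant interpolation `Π₁u'` of the derivative:
`Π₁u'(τ) = (u(t_l) - u(t_{l-1}))/Δt` for `τ ∈ (t_{l-1}, t_l]`. -/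
noncomputable def Pi1 (T : ℝ) (n : ℕ) (u : ℝ → ℝ) (τ : ℝ) : ℝ :=
  (u (tk T n ⌈τ / dt T n⌉₊) - u (tk T n (⌈τ / dt T n⌉₊ - 1))) / dt T n

/-- The ESA hypothesis with tolerance `ε`:
`|s^{-a} - Σ_{i=Nlo+1}^{Nhi} θ_{a,i} e^{-λ_i s}| ≤ ε s^{-a}` for all `s ∈ [Dt/T, 1]`. -/
def ESAhyp (a Dt T ε h : ℝ) (Nlo Nhi : ℤ) : Prop :=
  ∀ s ∈ Set.Icc (Dt / T) 1,
    |s ^ (-a) - ∑ i ∈ Finset.Icc (Nlo + 1) Nhi, thESA a h i * Real.exp (-(lamESA h i) * s)|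
      ≤ ε * s ^ (-a)

theorem dt_pos {T : ℝ} (hT : 0 < T) {n : ℕ} (hn : 0 < n) : 0 < dt T n :=
  div_pos hT (Nat.cast_pos.mpr hn)

theorem Pi1_eq_of_mem_Ioc {T : ℝ} {n : ℕ} (hdt : 0 < dt T n) (u : ℝ → ℝ) {m : ℕ} {τ : ℝ}
    (hτ : τ ∈ Set.Ioc (tk T n m) (tk T n (m + 1))) :
    Pi1 T n u τ = (u (tk T n (m + 1)) - u (tk T n m)) / dt T n := by
  have hceil : ⌈τ / dt T n⌉₊ = m + 1 := by
    rw [Nat.ceil_eq_iff (Nat.succ_ne_zero m)]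
    exact ⟨(lt_div_iff₀ hdt).2 hτ.1, (div_le_iff₀ hdt).2 hτ.2⟩
  simp only [Pi1, hceil, Nat.add_sub_cancel]

theorem tk_le_tk_succ {T : ℝ} {n : ℕ} (hdt : 0 < dt T n) (m : ℕ) :
    tk T n m ≤ tk T n (m + 1) := by
  simp only [tk, Nat.cast_add, Nat.cast_one]
  nlinarith

theorem intervalIntegrable_Pi1_mul {T : ℝ} {n : ℕ} (hdt : 0 < dt T n) (u : ℝ → ℝ)
    {g : ℝ → ℝ} (hg : Continuous g) (m : ℕ) :
    IntervalIntegrable (fun τ => Pi1 T n u τ * g τ) volume (tk T n m) (tk T n (m + 1)) := by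
  have h := (hg.intervalIntegrable (tk T n m) (tk T n (m + 1)) (μ := volume)).const_mul
    ((u (tk T n (m + 1)) - u (tk T n m)) / dt T n)
  refine h.congr fun τ hτ => ?_
  rw [Set.uIoc_of_le (tk_le_tk_succ hdt m)] at hτ
  simp only [Pi1_eq_of_mem_Ioc hdt u hτ]

theorem integral_Pi1_mul {T : ℝ} {n : ℕ} (hdt : 0 < dt T n) (u g : ℝ → ℝ) (m : ℕ) :
    ∫ τ in (tk T n m)..(tk T n (m + 1)), Pi1 T n u τ * g τ
      = (u (tk T n (m + 1)) - u (tk T n m)) / dt T n *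
          ∫ τ in (tk T n m)..(tk T n (m + 1)), g τ := by
  rw [← intervalIntegral.integral_const_mul]
  refine intervalIntegral.integral_congr_ae (Filter.Eventually.of_forall fun τ hτ => ?_)
  rw [Set.uIoc_of_le (tk_le_tk_succ hdt m)] at hτ
  rw [Pi1_eq_of_mem_Ioc hdt u hτ]

theorem integral_exp_neg_mul_sub_div {T c : ℝ} (hT : T ≠ 0) (hc : c ≠ 0) (s a b : ℝ) :
    ∫ τ in a..b, Real.exp (-c * (s - τ) / T)
      = T / c * (Real.exp (-c * (s - b) / T) - Real.exp (-c * (s - a) / T)) := by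
  have hderiv (τ : ℝ) : HasDerivAt (fun τ => T / c * Real.exp (-c * (s - τ) / T))
      (Real.exp (-c * (s - τ) / T)) τ := by
    refine ((((((hasDerivAt_id' τ).const_sub s).const_mul (-c)).div_const T).exp).const_mul
      (T / c)).congr_deriv ?_
    field_simp
  rw [intervalIntegral.integral_eq_sub_of_hasDerivAt (fun τ _ => hderiv τ)
    (Continuous.intervalIntegrable (by fun_prop) a b)]
  ring

/-- The recursion for the history term: for λ > 0 and 2 ≤ k ≤ n, with
v_k = ∫_0^{t_{k−1}} Π₁u′(τ) e^{−λ(t_k−τ)/T} dτ,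
v_k = e^{−λΔt/T} v_{k−1} + T (e^{−λΔt/T} − e^{−2λΔt/T})/(λΔt) (u(t_{k−1}) − u(t_{k−2})). -/
theorem history_recursion (T : ℝ) (hT : 1 ≤ T) (n : ℕ) (hn : 0 < n)
    (lam0 : ℝ) (hlam : 0 < lam0) (u : ℝ → ℝ) (k : ℕ) (hk2 : 2 ≤ k) (hkn : k ≤ n) :
    (∫ τ in (0:ℝ)..(tk T n (k-1)), Pi1 T n u τ * Real.exp (-lam0 * (tk T n k - τ) / T))
      = Real.exp (-lam0 * dt T n / T) *
          (∫ τ in (0:ℝ)..(tk T n (k-2)), Pi1 T n u τ * Real.exp (-lam0 * (tk T n (k-1) - τ) / T))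
        + T * (Real.exp (-lam0 * dt T n / T) - Real.exp (-2 * lam0 * dt T n / T)) /
            (lam0 * dt T n) * (u (tk T n (k-1)) - u (tk T n (k-2))) := by
  have hT0 : 0 < T := zero_lt_one.trans_le hT
  have hdt := dt_pos hT0 hn
  obtain ⟨m, rfl⟩ := Nat.exists_eq_add_of_le' hk2
  simp only [Nat.add_sub_cancel, show m + 2 - 1 = m + 1 from rfl]
  have hg : Continuous fun τ => Real.exp (-lam0 * (tk T n (m + 2) - τ) / T) := by fun_prop
  have hint (j : ℕ) := intervalIntegrable_Pi1_mul hdt u hg j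
  have hint0 := IntervalIntegrable.trans_iterate (a := tk T n) (n := m) fun j _ => hint j
  have htk0 : tk T n 0 = 0 := by simp [tk]
  rw [htk0] at hint0
  rw [← intervalIntegral.integral_add_adjacent_intervals hint0 (hint m),
    integral_Pi1_mul hdt, integral_exp_neg_mul_sub_div hT0.ne' hlam.ne',
    ← intervalIntegral.integral_const_mul]
  have hstep1 : tk T n (m + 2) - tk T n (m + 1) = dt T n := by
    simp only [tk]; push_cast; ring
  have hstep2 : tk T n (m + 2) - tk T n m = 2 * dt T n := by
    simp only [tk]; push_cast; ring
  congr 1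
  · congr 1
    funext τ
    rw [mul_left_comm, ← Real.exp_add, ← hstep1]
    ring_nf
  · rw [hstep1, hstep2, show -lam0 * (2 * dt T n) = -2 * lam0 * dt T n by ring]
    field_simp
end

section
/- Suppose the ESA hypothesis with tolerance ε ∈ (0,1) holds. Then for every 2 ≤ k ≤ n, |b_{k−1}^k| ≤ b_{k−1}^k + 2·ε_k. -/
open Real MeasureTheory Finset

/-- `Ib k j = Σ_i θ_{a,i} ∫_{t_{j-1}}^{t_j} e^{-λ_i (t_k - τ)/T} dτ`. -/
noncomputable def Ib (T : ℝ) (n : ℕ) (a h : ℝ) (Nlo Nhi : ℤ) (k j : ℕ) : ℝ :=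
  ∑ i ∈ Finset.Icc (Nlo + 1) Nhi,
    thESA a h i * ∫ τ in (tk T n (j-1))..(tk T n j), Real.exp (-(lamESA h i) * (tk T n k - τ) / T)

/-- The coefficients `b_l^k` of the fast ESA scheme (with `a` the order at level `k`):
`b_0^1 = 1`; for `k ≥ 2`, `b_0^k = T^{-a} Δt^{a-1}(1-a) Ib k 1`,
`b_{k-1}^k = 1 - T^{-a} Δt^{a-1}(1-a) Ib k (k-1)`, and
`b_l^k = T^{-a} Δt^{a-1}(1-a) (Ib k (l+1) - Ib k l)` for `1 ≤ l ≤ k-2`. -/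
noncomputable def bcoef (T : ℝ) (n : ℕ) (a h : ℝ) (Nlo Nhi : ℤ) (k l : ℕ) : ℝ :=
  if k = 1 then 1
  else if l = 0 then T ^ (-a) * (dt T n) ^ (a - 1) * (1 - a) * Ib T n a h Nlo Nhi k 1
  else if l = k - 1 then
    1 - T ^ (-a) * (dt T n) ^ (a - 1) * (1 - a) * Ib T n a h Nlo Nhi k (k-1)
  else T ^ (-a) * (dt T n) ^ (a - 1) * (1 - a) *
    (Ib T n a h Nlo Nhi k (l+1) - Ib T n a h Nlo Nhi k l)

/-- `ε_k = (ε/(1+ε)) T^{-a} Δt^{a-1} (1-a) Σ_i θ_{a,i} ∫_{t_{k-2}}^{t_{k-1}} e^{-λ_i(t_k-τ)/T} dτ`. -/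
noncomputable def epsk (T : ℝ) (n : ℕ) (a h ε : ℝ) (Nlo Nhi : ℤ) (k : ℕ) : ℝ :=
  (ε / (1 + ε)) * T ^ (-a) * (dt T n) ^ (a - 1) * (1 - a) * Ib T n a h Nlo Nhi k (k-1)

theorem tk_nonneg {T : ℝ} (hT : 0 ≤ T) (n k : ℕ) : 0 ≤ tk T n k := by
  unfold tk dt; positivity

theorem tk_le {T : ℝ} (hT : 0 ≤ T) {n k : ℕ} (hkn : k ≤ n) : tk T n k ≤ T := by
  have hkn' : (k : ℝ) ≤ n := by exact_mod_cast hkn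
  rw [tk, dt, mul_div_left_comm]
  exact mul_le_of_le_one_right hT (div_le_one_of_le₀ hkn' n.cast_nonneg)

theorem tk_succ (T : ℝ) (n k : ℕ) : tk T n (k + 1) = tk T n k + dt T n := by
  simp only [tk]; push_cast; ring

theorem thESA_nonneg {a h : ℝ} (ha : 0 < a) (hh : 0 ≤ h) (i : ℤ) : 0 ≤ thESA a h i := by
  have := Real.Gamma_pos_of_pos ha
  unfold thESA; positivity

theorem Ib_nonneg {T : ℝ} (hT : 0 ≤ T) (n : ℕ) {a h : ℝ} (ha : 0 < a) (hh : 0 ≤ h)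
    (Nlo Nhi : ℤ) (k j : ℕ) : 0 ≤ Ib T n a h Nlo Nhi k j := by
  refine Finset.sum_nonneg fun i _ => mul_nonneg (thESA_nonneg ha hh i) ?_
  refine intervalIntegral.integral_nonneg ?_ fun _ _ => (Real.exp_pos _).le
  have hj : ((j - 1 : ℕ) : ℝ) ≤ j := by exact_mod_cast Nat.sub_le j 1
  exact mul_le_mul_of_nonneg_right hj (div_nonneg hT n.cast_nonneg)

/-- Under the ESA hypothesis the exponential sum is at most `(1 + ε) (Δt / T) ^ (-a)`. -/
theorem ESAhyp.sum_le {a Dt T ε h : ℝ} {Nlo Nhi : ℤ} (H : ESAhyp a Dt T ε h Nlo Nhi)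
    (ha : 0 ≤ a) (hDt : 0 < Dt / T) (hε : 0 ≤ ε) {s : ℝ} (hs : s ∈ Set.Icc (Dt / T) 1) :
    ∑ i ∈ Finset.Icc (Nlo + 1) Nhi, thESA a h i * Real.exp (-(lamESA h i) * s)
      ≤ (1 + ε) * (Dt / T) ^ (-a) := by
  have hanti : s ^ (-a) ≤ (Dt / T) ^ (-a) :=
    Real.rpow_le_rpow_of_nonpos hDt hs.1 (neg_nonpos.mpr ha)
  have habs := (abs_le.mp (H s hs)).1
  calc _ ≤ (1 + ε) * s ^ (-a) := by linarith
    _ ≤ _ := by gcongr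

/-- Under the ESA hypothesis, `Ib` over the next-to-last subinterval is controlled by the
value of the kernel at `Δt / T`. -/
theorem Ib_le_of_ESAhyp {T : ℝ} (hT : 0 < T) {n : ℕ} (hn : 0 < n) {a h ε : ℝ} (ha : 0 ≤ a)
    (hε : 0 ≤ ε) {Nlo Nhi : ℤ} {m : ℕ} (hmn : m + 2 ≤ n)
    (H : ESAhyp a (dt T n) T ε h Nlo Nhi) :
    Ib T n a h Nlo Nhi (m + 2) (m + 1) ≤ (1 + ε) * (dt T n / T) ^ (-a) * dt T n := by
  have hd := dt_pos hT hn
  have h1 := tk_succ T n m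
  have h2 := tk_succ T n (m + 1)
  have hle : tk T n m ≤ tk T n (m + 1) := by linarith
  have hcont : ∀ i ∈ Finset.Icc (Nlo + 1) Nhi, IntervalIntegrable
      (fun τ => thESA a h i * Real.exp (-(lamESA h i) * (tk T n (m + 2) - τ) / T))
      volume (tk T n m) (tk T n (m + 1)) := fun i _ =>
    Continuous.intervalIntegrable (by fun_prop) _ _
  have hIb : Ib T n a h Nlo Nhi (m + 2) (m + 1) =
      ∫ τ in (tk T n m)..(tk T n (m + 1)), ∑ i ∈ Finset.Icc (Nlo + 1) Nhi,
        thESA a h i * Real.exp (-(lamESA h i) * (tk T n (m + 2) - τ) / T) := by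
    rw [intervalIntegral.integral_finsetSum hcont]
    simp [Ib, intervalIntegral.integral_const_mul]
  have hconst : ∫ _ in (tk T n m)..(tk T n (m + 1)), (1 + ε) * (dt T n / T) ^ (-a) =
      (1 + ε) * (dt T n / T) ^ (-a) * dt T n := by
    rw [intervalIntegral.integral_const, smul_eq_mul, h1]; ring
  rw [hIb, ← hconst]
  refine intervalIntegral.integral_mono_on hle
    (Continuous.intervalIntegrable (by fun_prop) _ _) intervalIntegrable_const fun τ hτ => ?_
  simp only [mul_div_assoc]
  refine H.sum_le ha (div_pos hd hT) hε ⟨?_, ?_⟩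
  · gcongr
    linarith [hτ.2]
  · rw [div_le_one hT]
    linarith [hτ.1, tk_nonneg hT.le n m, tk_le hT.le hmn]

/-- Lemma 5 iii): under the ESA hypothesis, |b_{k−1}^k| ≤ b_{k−1}^k + 2 ε_k. -/
theorem abs_bcoef_last_le
    (T : ℝ) (hT : 1 ≤ T) (n : ℕ) (hn : 0 < n)
    (alo ahi : ℝ) (halo : 0 < alo) (hlh : alo ≤ ahi) (hahi : ahi < 1)
    (αf : ℝ → ℝ) (hα : ∀ s ∈ Set.Icc (0:ℝ) T, αf s ∈ Set.Icc alo ahi)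
    (h : ℝ) (hh : 0 < h) (Nlo Nhi : ℤ) (hN : Nlo < Nhi)
    (ε : ℝ) (hε : ε ∈ Set.Ioo (0:ℝ) 1)
    (k : ℕ) (hk2 : 2 ≤ k) (hkn : k ≤ n)
    (hesa : ESAhyp (αf (tk T n k)) (dt T n) T ε h Nlo Nhi) :
    |bcoef T n (αf (tk T n k)) h Nlo Nhi k (k-1)|
      ≤ bcoef T n (αf (tk T n k)) h Nlo Nhi k (k-1)
          + 2 * epsk T n (αf (tk T n k)) h ε Nlo Nhi k := by
  have hT0 : 0 < T := by linarith
  have hd := dt_pos hT0 hn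
  obtain ⟨ha1, ha2⟩ := hα _ ⟨tk_nonneg hT0.le n k, tk_le hT0.le hkn⟩
  generalize αf (tk T n k) = a at *
  have ha : 0 < a := by linarith
  have hε0 := hε.1
  obtain ⟨m, rfl⟩ := Nat.exists_eq_add_of_le' hk2
  have hle := Ib_le_of_ESAhyp hT0 hn ha.le hε0.le hkn hesa
  have hnn := Ib_nonneg hT0.le n ha hh.le Nlo Nhi (m + 2) (m + 1)
  simp only [bcoef, epsk, show m + 2 - 1 = m + 1 from rfl,
    show m + 2 ≠ 1 by omega, Nat.succ_ne_zero, if_true, if_false]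
  have hc : 0 ≤ T ^ (-a) * dt T n ^ (a - 1) * (1 - a) :=
    mul_nonneg (by positivity) (by linarith)
  have hcancel : T ^ (-a) * dt T n ^ (a - 1) * ((dt T n / T) ^ (-a) * dt T n) = 1 := by
    rw [Real.div_rpow hd.le hT0.le, Real.rpow_sub_one hd.ne', Real.rpow_neg hd.le]
    have := Real.rpow_pos_of_pos hd a
    have := Real.rpow_pos_of_pos hT0 (-a)
    field_simp
  have hQ : T ^ (-a) * dt T n ^ (a - 1) * (1 - a) * Ib T n a h Nlo Nhi (m + 2) (m + 1)
      ≤ 1 + ε :=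
    calc _ ≤ T ^ (-a) * dt T n ^ (a - 1) * (1 - a) *
          ((1 + ε) * (dt T n / T) ^ (-a) * dt T n) := mul_le_mul_of_nonneg_left hle hc
      _ = (1 - a) * (1 + ε) * (T ^ (-a) * dt T n ^ (a - 1) *
          ((dt T n / T) ^ (-a) * dt T n)) := by ring
      _ = (1 - a) * (1 + ε) := by rw [hcancel, mul_one]
      _ ≤ 1 + ε := mul_le_of_le_one_left (by linarith) (by linarith)
  have hQ0 := mul_nonneg hc hnn
  have hassoc : ε / (1 + ε) * T ^ (-a) * dt T n ^ (a - 1) * (1 - a) *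
      Ib T n a h Nlo Nhi (m + 2) (m + 1) = ε / (1 + ε) *
        (T ^ (-a) * dt T n ^ (a - 1) * (1 - a) * Ib T n a h Nlo Nhi (m + 2) (m + 1)) := by
    ring
  rw [hassoc]
  generalize T ^ (-a) * dt T n ^ (a - 1) * (1 - a) *
    Ib T n a h Nlo Nhi (m + 2) (m + 1) = Q at *
  have hE : 0 ≤ ε / (1 + ε) * Q := by positivity
  have hsplit : Q - ε / (1 + ε) * Q = Q / (1 + ε) := by field_simp; ring
  have hdiv : Q / (1 + ε) ≤ 1 := (div_le_one (by linarith)).mpr hQ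
  rw [abs_le]
  constructor <;> linarith
end

section
/- Suppose the ESA hypothesis with tolerance ε ∈ (0,1) holds. Then for every 2 ≤ k ≤ n, b_0^k ≥ (1−ε)·(k^{1−α_k} − (k−1)^{1−α_k}) ≥ (1−ε)·(1−α_k)·k^{−α_k}. -/
open Real MeasureTheory Finset

theorem one_sub_mul_rpow_neg_le_rpow_sub_rpow {x a : ℝ} (hx : 1 ≤ x) (ha0 : 0 ≤ a) (ha1 : a ≤ 1) :
    (1 - a) * x ^ (-a) ≤ x ^ (1 - a) - (x - 1) ^ (1 - a) := by
  have hx0 : 0 < x := by linarith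
  have hinv : x⁻¹ ≤ 1 := inv_le_one_of_one_le₀ hx
  have bernoulli : (1 + -x⁻¹) ^ (1 - a) ≤ 1 + (1 - a) * -x⁻¹ :=
    rpow_one_add_le_one_add_mul_self (by linarith) (by linarith) (by linarith)
  have hfactor : (x - 1) ^ (1 - a) = x ^ (1 - a) * (1 + -x⁻¹) ^ (1 - a) := by
    rw [← Real.mul_rpow hx0.le (by linarith)]
    congr 1
    field_simp
    ring
  have hpow : x ^ (-a) = x ^ (1 - a) * x⁻¹ := by
    rw [← Real.rpow_neg_one, ← Real.rpow_add hx0]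
    congr 1
    ring
  rw [hfactor, hpow]
  have := mul_le_mul_of_nonneg_left bernoulli (Real.rpow_nonneg hx0.le (1 - a))
  linarith

theorem integral_div_rpow_neg {T d x a : ℝ} (hT : 0 < T) (hd : 0 < d) (hx : 1 ≤ x) (ha : a < 1) :
    ∫ τ in (0 : ℝ)..d, ((x * d - τ) / T) ^ (-a)
      = T ^ a * (d ^ (1 - a) * ((x ^ (1 - a) - (x - 1) ^ (1 - a)) / (1 - a))) := by
  have hpull : ∫ τ in (0 : ℝ)..d, ((x * d - τ) / T) ^ (-a)
      = ∫ τ in (0 : ℝ)..d, T ^ a * (x * d - τ) ^ (-a) := by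
    refine intervalIntegral.integral_congr fun τ hτ => ?_
    rw [Set.uIcc_of_le hd.le] at hτ
    have : 0 ≤ x * d - τ := by nlinarith [hτ.2]
    rw [Real.div_rpow this hT.le, Real.rpow_neg hT.le, div_inv_eq_mul, mul_comm]
  rw [hpull, intervalIntegral.integral_const_mul,
    intervalIntegral.integral_comp_sub_left (fun y => y ^ (-a)),
    integral_rpow (Or.inl (by linarith)), show -a + 1 = 1 - a by ring, sub_zero,
    show x * d - d = (x - 1) * d by ring, Real.mul_rpow (by linarith) hd.le,
    Real.mul_rpow (by linarith) hd.le]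
  ring

theorem Ib_one_eq_integral_sum (T : ℝ) (n : ℕ) (a h : ℝ) (Nlo Nhi : ℤ) (k : ℕ) :
    Ib T n a h Nlo Nhi k 1 = ∫ τ in (0 : ℝ)..dt T n, ∑ i ∈ Finset.Icc (Nlo + 1) Nhi,
      thESA a h i * Real.exp (-(lamESA h i) * ((k * dt T n - τ) / T)) := by
  rw [intervalIntegral.integral_finsetSum
    fun i _ => Continuous.intervalIntegrable (by fun_prop) _ _]
  simp [Ib, tk, ← mul_div_assoc, neg_div]

/-- Under the ESA hypothesis, b_0^k ≥ (1−ε)(k^{1−α_k} − (k−1)^{1−α_k}) ≥ (1−ε)(1−α_k)k^{−α_k}. -/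
theorem bcoef_zero_lower_bound
    (T : ℝ) (hT : 1 ≤ T) (n : ℕ) (hn : 0 < n)
    (alo ahi : ℝ) (halo : 0 < alo) (hlh : alo ≤ ahi) (hahi : ahi < 1)
    (αf : ℝ → ℝ) (hα : ∀ s ∈ Set.Icc (0:ℝ) T, αf s ∈ Set.Icc alo ahi)
    (h : ℝ) (hh : 0 < h) (Nlo Nhi : ℤ) (hN : Nlo < Nhi)
    (ε : ℝ) (hε : ε ∈ Set.Ioo (0:ℝ) 1)
    (k : ℕ) (hk2 : 2 ≤ k) (hkn : k ≤ n)
    (hesa : ESAhyp (αf (tk T n k)) (dt T n) T ε h Nlo Nhi) :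
    (1 - ε) * ((k : ℝ) ^ (1 - αf (tk T n k)) - ((k : ℝ) - 1) ^ (1 - αf (tk T n k)))
        ≤ bcoef T n (αf (tk T n k)) h Nlo Nhi k 0
      ∧ (1 - ε) * (1 - αf (tk T n k)) * (k : ℝ) ^ (-(αf (tk T n k)))
        ≤ (1 - ε) * ((k : ℝ) ^ (1 - αf (tk T n k)) - ((k : ℝ) - 1) ^ (1 - αf (tk T n k))) := by
  have hnR : (0 : ℝ) < n := by exact_mod_cast hn
  have hT0 : 0 < T := by linarith
  have hd : 0 < dt T n := div_pos hT0 hnR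
  have hnd : n * dt T n = T := by unfold dt; field_simp
  have hk : (2 : ℝ) ≤ k := by exact_mod_cast hk2
  have hknR : (k : ℝ) ≤ n := by exact_mod_cast hkn
  have hkT : k * dt T n ≤ T :=
    (mul_le_mul_of_nonneg_right hknR hd.le).trans_eq hnd
  obtain ⟨hlo, hhi⟩ := hα (tk T n k) ⟨by unfold tk; positivity, hkT⟩
  generalize αf (tk T n k) = a at *
  have ha0 : 0 < a := by linarith
  have ha1 : a < 1 := by linarith
  have hε1 : 0 ≤ 1 - ε := by linarith [hε.2]
  refine ⟨?_, ?_⟩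
  · have hpos : ∀ τ ∈ Set.Icc 0 (dt T n), 0 < k * dt T n - τ := fun τ hτ => by
      nlinarith [hτ.2]
    have hint : (1 - ε) * ∫ τ in (0 : ℝ)..dt T n, ((k * dt T n - τ) / T) ^ (-a)
        ≤ Ib T n a h Nlo Nhi k 1 := by
      rw [Ib_one_eq_integral_sum, ← intervalIntegral.integral_const_mul]
      refine intervalIntegral.integral_mono_on hd.le ?_
        (Continuous.intervalIntegrable (by fun_prop) _ _) fun τ hτ => ?_
      · refine ContinuousOn.intervalIntegrable ?_
        rw [Set.uIcc_of_le hd.le]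
        refine continuousOn_const.mul (ContinuousOn.rpow_const (by fun_prop) fun τ hτ => Or.inl ?_)
        exact (div_pos (hpos τ hτ) hT0).ne'
      · have hs : (k * dt T n - τ) / T ∈ Set.Icc (dt T n / T) 1 := by
          refine ⟨?_, (div_le_one hT0).2 (by linarith [hτ.1])⟩
          gcongr
          nlinarith [hτ.2]
        linarith [(abs_le.1 (hesa _ hs)).2]
    rw [integral_div_rpow_neg hT0 hd (by linarith) ha1] at hint
    have hb : bcoef T n a h Nlo Nhi k 0
        = T ^ (-a) * (dt T n) ^ (a - 1) * (1 - a) * Ib T n a h Nlo Nhi k 1 := by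
      simp [bcoef, show k ≠ 1 by omega]
    have hTa : T ^ (-a) * T ^ a = 1 := by rw [← Real.rpow_add hT0]; simp
    have hda : dt T n ^ (a - 1) * dt T n ^ (1 - a) = 1 := by rw [← Real.rpow_add hd]; simp
    have ha1' : 1 - a ≠ 0 := by linarith
    rw [hb]
    refine le_trans (le_of_eq ?_) (mul_le_mul_of_nonneg_left hint
      (mul_nonneg (by positivity) (by linarith)))
    generalize (k : ℝ) ^ (1 - a) - ((k : ℝ) - 1) ^ (1 - a) = D
    calc (1 - ε) * D = (T ^ (-a) * T ^ a) * (dt T n ^ (a - 1) * dt T n ^ (1 - a))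
          * ((1 - ε) * ((1 - a) * (D / (1 - a)))) := by
            rw [hTa, hda, mul_div_cancel₀ _ ha1']; ring
      _ = _ := by ring
  · rw [mul_assoc]
    exact mul_le_mul_of_nonneg_left
      (one_sub_mul_rpow_neg_le_rpow_sub_rpow (by linarith) ha0.le ha1.le) hε1
end
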